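/- Let 𝔤 be a real Lie algebra of finite dimension n ≥ 3. Then the following are equivalent: (i) 𝔤 is indecomposable (𝔤 is not the direct sum of two nonzero ideals) and its derived ideal 𝔤¹ = [𝔤,𝔤] is 1-dimensional; (ii) there exists a positive integer m with n = 2m+1 such that 𝔤 is isomorphic as a real Lie algebra to the Heisenberg Lie algebra 𝔥_{2m+1} (in particular n is odd). -/

import Mathlib

/-- The Kirillov form associated to a linear functional `F` on a real Lie algebra `L`:
the skew-symmetric bilinear form `B_F(X, Y) = F ⁅X, Y⁆`, bundled as a linear map
`L →ₗ[ℝ] L →ₗ[ℝ] ℝ`. -/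
def kirillovForm {L : Type*} [LieRing L] [LieAlgebra ℝ L] (F : Module.Dual ℝ L) :
    L →ₗ[ℝ] L →ₗ[ℝ] ℝ :=
  LinearMap.mk₂ ℝ (fun X Y => F ⁅X, Y⁆)
    (fun X X' Y => by simp)
    (fun c X Y => by simp)
    (fun X Y Y' => by simp)
    (fun c X Y => by simp)

/-- The rank of the Kirillov form `B_F`. -/
noncomputable def kirillovRank {L : Type*} [LieRing L] [LieAlgebra ℝ L]
    (F : Module.Dual ℝ L) : ℕ :=
  Module.finrank ℝ (LinearMap.range (kirillovForm F))

/-- A real Lie algebra is an MD-algebra if all Kirillov forms `B_F` of nonzero rank have the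
same rank. -/
def IsMDAlgebra (L : Type*) [LieRing L] [LieAlgebra ℝ L] : Prop :=
  ∀ F G : Module.Dual ℝ L, kirillovRank F ≠ 0 → kirillovRank G ≠ 0 →
    kirillovRank F = kirillovRank G

def Heisenberg (m : ℕ) : Type := (Fin m → ℝ) × (Fin m → ℝ) × ℝ

namespace Heisenberg
variable {m : ℕ}

noncomputable instance : AddCommGroup (Heisenberg m) :=
  inferInstanceAs (AddCommGroup ((Fin m → ℝ) × (Fin m → ℝ) × ℝ))
noncomputable instance : Module ℝ (Heisenberg m) :=
  inferInstanceAs (Module ℝ ((Fin m → ℝ) × (Fin m → ℝ) × ℝ))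

noncomputable instance : LieRing (Heisenberg m) where
  bracket x y := (0, 0, ∑ i, (x.1 i * y.2.1 i - y.1 i * x.2.1 i))
  add_lie x y z := by
    refine Prod.ext ?_ (Prod.ext ?_ ?_)
    · show (0 : Fin m → ℝ) = 0 + 0; simp
    · show (0 : Fin m → ℝ) = 0 + 0; simp
    · show (∑ i, ((x + y).1 i * z.2.1 i - z.1 i * (x + y).2.1 i)) =
        (∑ i, (x.1 i * z.2.1 i - z.1 i * x.2.1 i)) + (∑ i, (y.1 i * z.2.1 i - z.1 i * y.2.1 i))
      rw [← Finset.sum_add_distrib]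
      refine Finset.sum_congr rfl fun i _ => ?_
      show ((x.1 + y.1) i * z.2.1 i - z.1 i * ((x.2.1 + y.2.1)) i) = _
      simp only [Pi.add_apply]; ring
  lie_add x y z := by
    refine Prod.ext ?_ (Prod.ext ?_ ?_)
    · show (0 : Fin m → ℝ) = 0 + 0; simp
    · show (0 : Fin m → ℝ) = 0 + 0; simp
    · show (∑ i, (x.1 i * (y + z).2.1 i - (y + z).1 i * x.2.1 i)) =
        (∑ i, (x.1 i * y.2.1 i - y.1 i * x.2.1 i)) + (∑ i, (x.1 i * z.2.1 i - z.1 i * x.2.1 i))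
      rw [← Finset.sum_add_distrib]
      refine Finset.sum_congr rfl fun i _ => ?_
      show (x.1 i * ((y.2.1 + z.2.1)) i - ((y.1 + z.1)) i * x.2.1 i) = _
      simp only [Pi.add_apply]; ring
  lie_self x := by
    refine Prod.ext ?_ (Prod.ext ?_ ?_)
    · show (0 : Fin m → ℝ) = 0; rfl
    · show (0 : Fin m → ℝ) = 0; rfl
    · show (∑ i, (x.1 i * x.2.1 i - x.1 i * x.2.1 i)) = 0
      simp
  leibniz_lie x y z := by
    refine Prod.ext ?_ (Prod.ext ?_ ?_)
    · show (0 : Fin m → ℝ) = 0 + 0; simp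
    · show (0 : Fin m → ℝ) = 0 + 0; simp
    · show (∑ i, (x.1 i * (0:Fin m → ℝ) i - (0:Fin m → ℝ) i * x.2.1 i)) =
        (∑ i, ((0:Fin m → ℝ) i * z.2.1 i - z.1 i * (0:Fin m → ℝ) i)) +
        (∑ i, (y.1 i * (0:Fin m → ℝ) i - (0:Fin m → ℝ) i * y.2.1 i))
      simp

noncomputable instance : LieAlgebra ℝ (Heisenberg m) where
  lie_smul c x y := by
    refine Prod.ext ?_ (Prod.ext ?_ ?_)
    · show (0 : Fin m → ℝ) = c • 0; simp
    · show (0 : Fin m → ℝ) = c • 0; simp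
    · show (∑ i, (x.1 i * (c • y).2.1 i - (c • y).1 i * x.2.1 i)) =
        c • (∑ i, (x.1 i * y.2.1 i - y.1 i * x.2.1 i))
      rw [Finset.smul_sum]
      refine Finset.sum_congr rfl fun i _ => ?_
      show (x.1 i * (c • y.2.1) i - (c • y.1) i * x.2.1 i) = _
      simp only [Pi.smul_apply, smul_eq_mul]; ring

end Heisenberg

/-- A real Lie algebra is decomposable if it is the direct sum of two nonzero ideals. -/
def IsDecomposable (L : Type*) [LieRing L] [LieAlgebra ℝ L] : Prop :=
  ∃ I J : LieIdeal ℝ L, I ≠ ⊥ ∧ J ≠ ⊥ ∧ IsCompl I J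

lemma finrank_span_pair_le {K V : Type*} [Field K] [AddCommGroup V] [Module K V] (a b : V) :
    Module.finrank K (Submodule.span K {a, b}) ≤ 2 := by
  classical
  have h := finrank_span_finset_le_card (R := K) ({a, b} : Finset V)
  rw [Finset.coe_pair] at h
  exact h.trans Finset.card_le_two

section HyperbolicFamily

variable {K V : Type*} [Field K] [AddCommGroup V] [Module K V]

/-- Two families of vectors form a hyperbolic family for a bilinear form `B` if they satisfy the
canonical relations of a symplectic basis (without being required to span). -/
structure IsHyperbolicFamily (B : V →ₗ[K] V →ₗ[K] K) {m : ℕ} (p q : Fin m → V) : Prop where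
  left_left : ∀ i j, B (p i) (p j) = 0
  right_right : ∀ i j, B (q i) (q j) = 0
  left_right : ∀ i j, B (p i) (q j) = if i = j then 1 else 0

namespace IsHyperbolicFamily

variable {B : V →ₗ[K] V →ₗ[K] K} {m : ℕ} {p q : Fin m → V}

lemma right_left (h : IsHyperbolicFamily B p q) (hB : B.IsAlt) (i j : Fin m) :
    B (q i) (p j) = if i = j then -1 else 0 := by
  rw [← hB.neg, h.left_right]
  simp only [eq_comm (a := j)]
  split_ifs <;> simp

lemma apply_left (h : IsHyperbolicFamily B p q) (x y : Fin m → K) (j : Fin m) :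
    B (p j) (∑ i, x i • p i + ∑ i, y i • q i) = y j := by
  simp [h.left_left, h.left_right]

lemma apply_right (h : IsHyperbolicFamily B p q) (hB : B.IsAlt) (x y : Fin m → K) (j : Fin m) :
    B (q j) (∑ i, x i • p i + ∑ i, y i • q i) = -x j := by
  simp [h.right_right, h.right_left hB]

lemma card_le_finrank [Module.Finite K V] (h : IsHyperbolicFamily B p q) :
    m ≤ Module.finrank K V := by
  have hp : LinearIndependent K p := by
    rw [Fintype.linearIndependent_iff]
    intro g hg i
    have := congrArg (fun v => B v (q i)) hg
    simpa [h.left_right] using this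
  simpa using hp.fintype_card_le_finrank

/-- A hyperbolic family is enlarged by a hyperbolic pair orthogonal to it. -/
lemma cons (h : IsHyperbolicFamily B p q) (hB : B.IsAlt) {v w : V} (hvw : B v w = 1)
    (hvp : ∀ i, B (p i) v = 0) (hvq : ∀ i, B (q i) v = 0)
    (hwp : ∀ i, B (p i) w = 0) (hwq : ∀ i, B (q i) w = 0) :
    IsHyperbolicFamily B (Fin.cons v p : Fin (m + 1) → V) (Fin.cons w q : Fin (m + 1) → V) where
  left_left i j := by
    refine Fin.cases ?_ (fun i => ?_) i <;> refine Fin.cases ?_ (fun j => ?_) j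
    · simpa using hB v
    · simp [hB.isRefl.eq_zero (hvp j)]
    · simp [hvp]
    · simp [h.left_left]
  right_right i j := by
    refine Fin.cases ?_ (fun i => ?_) i <;> refine Fin.cases ?_ (fun j => ?_) j
    · simpa using hB w
    · simp [hB.isRefl.eq_zero (hwq j)]
    · simp [hwq]
    · simp [h.right_right]
  left_right i j := by
    refine Fin.cases ?_ (fun i => ?_) i <;> refine Fin.cases ?_ (fun j => ?_) j
    · simpa using hvw
    · simp [hB.isRefl.eq_zero (hvq j), (Fin.succ_ne_zero j).symm]
    · simp [hwp]
    · simp [h.left_right]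

end IsHyperbolicFamily

/-- An alternating form on a finite-dimensional space has a hyperbolic family spanning the space
modulo the radical of the form. -/
lemma exists_isHyperbolicFamily [Module.Finite K V] (B : V →ₗ[K] V →ₗ[K] K) (hB : B.IsAlt) :
    ∃ (m : ℕ) (p q : Fin m → V), IsHyperbolicFamily B p q ∧
      ∀ v, ∃ x y : Fin m → K, B (v - (∑ i, x i • p i + ∑ i, y i • q i)) = 0 := by
  classical
  let S : ℕ → Prop := fun m => ∃ p q : Fin m → V, IsHyperbolicFamily B p q
  have hS0 : S 0 := ⟨0, 0, ⟨fun i => i.elim0, fun i => i.elim0, fun i => i.elim0⟩⟩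
  obtain ⟨p, q, h⟩ : S (Nat.findGreatest S (Module.finrank K V)) :=
    Nat.findGreatest_spec (Nat.zero_le _) hS0
  have hmax : ¬ S (Nat.findGreatest S (Module.finrank K V) + 1) := by
    intro hS
    have hle : Nat.findGreatest S (Module.finrank K V) + 1 ≤ Module.finrank K V := by
      obtain ⟨p, q, h⟩ := hS
      exact h.card_le_finrank
    have := Nat.le_findGreatest hle hS
    omega
  generalize Nat.findGreatest S (Module.finrank K V) = m at p q h hmax
  let R : V → V := fun v => v - (∑ i, (-B (q i) v) • p i + ∑ i, (B (p i) v) • q i)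
  have hRp : ∀ v i, B (p i) (R v) = 0 := fun v i => by
    simp only [R, map_sub, h.apply_left, sub_self]
  have hRq : ∀ v i, B (q i) (R v) = 0 := fun v i => by
    simp only [R, map_sub, h.apply_right hB, neg_neg, sub_self]
  refine ⟨m, p, q, h, fun v => ⟨fun i => -B (q i) v, fun i => B (p i) v, ?_⟩⟩
  change B (R v) = 0
  by_contra hne
  obtain ⟨w, hw⟩ : ∃ w, B (R v) w ≠ 0 := by
    by_contra! hall
    exact hne (LinearMap.ext hall)
  have hRw : B (R v) (R w) = B (R v) w := by
    have hp : ∀ i, B (R v) (p i) = 0 := fun i => by rw [← hB.neg, hRp, neg_zero]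
    have hq : ∀ i, B (R v) (q i) = 0 := fun i => by rw [← hB.neg, hRq, neg_zero]
    change B (R v) (w - _) = _
    simp [hp, hq]
  refine hmax ⟨_, _, h.cons hB (v := R v) (w := (B (R v) w)⁻¹ • R w) ?_ (hRp v) (hRq v) ?_ ?_⟩
  · simp [hRw, hw]
  · simp [hRp]
  · simp [hRq]

end HyperbolicFamily

section LieAlgebra

variable {L : Type*} [LieRing L] [LieAlgebra ℝ L]

lemma kirillovForm_apply (F : Module.Dual ℝ L) (x y : L) : kirillovForm F x y = F ⁅x, y⁆ := rfl

lemma kirillovForm_isAlt (F : Module.Dual ℝ L) : (kirillovForm F).IsAlt := fun x => by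
  simp [kirillovForm_apply]

lemma isDecomposable_of_isCompl {I J : Submodule ℝ L} (hI : I ≠ ⊥) (hJ : J ≠ ⊥)
    (hIJ : IsCompl I J) (hlieI : ∀ x : L, ∀ y ∈ I, ⁅x, y⁆ ∈ I)
    (hlieJ : ∀ x : L, ∀ y ∈ J, ⁅x, y⁆ ∈ J) :
    IsDecomposable L := by
  let I' : LieIdeal ℝ L := { I with lie_mem := fun {x y} hy => hlieI x y hy }
  let J' : LieIdeal ℝ L := { J with lie_mem := fun {x y} hy => hlieJ x y hy }
  refine ⟨I', J', ?_, ?_, ?_⟩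
  · rwa [Ne, ← LieSubmodule.toSubmodule_eq_bot]
  · rwa [Ne, ← LieSubmodule.toSubmodule_eq_bot]
  · rwa [← LieSubmodule.isCompl_toSubmodule]

/-- A Lie algebra of dimension at least three whose brackets all lie on a line spanned by a
non-central vector splits off the affine Lie algebra of the line. -/
lemma isDecomposable_of_lie_eq_smul_of_not_central [Module.Finite ℝ L]
    (hdim : 3 ≤ Module.finrank ℝ L) {z : L} (hlie : ∀ x y : L, ∃ c : ℝ, ⁅x, y⁆ = c • z)
    {b : L} (hb : ⁅b, z⁆ ≠ 0) : IsDecomposable L := by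
  have hz : z ≠ 0 := by rintro rfl; simp at hb
  obtain ⟨a, ha⟩ : ∃ a : L, ⁅a, z⁆ = z := by
    obtain ⟨c, hc⟩ := hlie b z
    have hc0 : c ≠ 0 := by rintro rfl; simp [hc] at hb
    exact ⟨c⁻¹ • b, by rw [smul_lie, hc, smul_smul, inv_mul_cancel₀ hc0, one_smul]⟩
  have hza : ⁅z, a⁆ = -z := by rw [← lie_skew, ha]
  let I : Submodule ℝ L := Submodule.span ℝ {a, z}
  let J : Submodule ℝ L :=
    LinearMap.ker (LieAlgebra.ad ℝ L a) ⊓ LinearMap.ker (LieAlgebra.ad ℝ L z)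
  have hmemJ : ∀ y, y ∈ J ↔ ⁅a, y⁆ = 0 ∧ ⁅z, y⁆ = 0 := fun y => by simp [J]
  have hzI : z ∈ I := Submodule.subset_span (by simp)
  have haI : a ∈ I := Submodule.subset_span (by simp)
  have hIJ : IsCompl I J := by
    constructor
    · rw [Submodule.disjoint_def]
      intro x hxI hxJ
      obtain ⟨s, t, rfl⟩ := Submodule.mem_span_pair.1 hxI
      obtain ⟨h1, h2⟩ := (hmemJ _).1 hxJ
      have ht : t = 0 := by simpa [ha, hz] using h1
      have hs : s = 0 := by simpa [hza, hz] using h2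
      simp [hs, ht]
    · rw [codisjoint_iff, eq_top_iff]
      intro x _
      obtain ⟨c, hc⟩ := hlie a x
      obtain ⟨d, hd⟩ := hlie z x
      refine Submodule.mem_sup.2 ⟨c • z - d • a, ?_, x - (c • z - d • a), ?_, by abel⟩
      · exact I.sub_mem (I.smul_mem _ hzI) (I.smul_mem _ haI)
      · rw [hmemJ]
        simp [ha, hza, hc, hd]
  refine isDecomposable_of_isCompl (fun h => ?_) (fun h => ?_) hIJ (fun x y _ => ?_)
    (fun x y hy => ?_)
  · exact hz (by simpa [h] using hzI)
  · have htop : I = ⊤ := by simpa [h] using hIJ.sup_eq_top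
    have hle : Module.finrank ℝ I ≤ 2 := finrank_span_pair_le a z
    rw [htop, finrank_top] at hle
    omega
  · obtain ⟨c, hc⟩ := hlie x y
    exact hc ▸ I.smul_mem c hzI
  · obtain ⟨hay, hzy⟩ := (hmemJ y).1 hy
    obtain ⟨c, hc⟩ := hlie x y
    obtain ⟨d, hd⟩ := hlie a x
    have h0 := leibniz_lie a x y
    rw [hay, hd, hc, lie_smul, ha, smul_lie, hzy, smul_zero, lie_zero, add_zero] at h0
    rw [hc, h0]
    exact J.zero_mem

/-- A central vector outside the line containing all brackets spans a direct factor. -/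
lemma isDecomposable_of_lie_eq_smul_of_central {z : L} (hz : z ≠ 0)
    (hlie : ∀ x y : L, ∃ c : ℝ, ⁅x, y⁆ = c • z) {w : L} (hw : ∀ x : L, ⁅x, w⁆ = 0)
    (hwz : w ∉ Submodule.span ℝ {z}) : IsDecomposable L := by
  have hw0 : w ≠ 0 := by rintro rfl; exact hwz (Submodule.zero_mem _)
  have hdisj : Disjoint (Submodule.span ℝ {z}) (Submodule.span ℝ {w}) :=
    (Submodule.disjoint_span_singleton' hw0).2 hwz
  obtain ⟨I, hzI, hI⟩ := hdisj.exists_isCompl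
  have hzI : z ∈ I := hzI (Submodule.mem_span_singleton_self z)
  refine isDecomposable_of_isCompl (fun h => hz (by simpa [h] using hzI)) (by simpa using hw0) hI
    (fun x y _ => ?_) (fun x y hy => ?_)
  · obtain ⟨c, hc⟩ := hlie x y
    exact hc ▸ I.smul_mem c hzI
  · obtain ⟨c, rfl⟩ := Submodule.mem_span_singleton.1 hy
    simp [hw]

/-- A Lie algebra whose brackets all lie on a line that contains the centre is indecomposable. -/
lemma not_isDecomposable_of_lie_eq_smul {z : L} (hz : z ≠ 0)
    (hlie : ∀ x y : L, ∃ c : ℝ, ⁅x, y⁆ = c • z)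
    (hcenter : ∀ x : L, (∀ y : L, ⁅x, y⁆ = 0) → ∃ c : ℝ, x = c • z) : ¬ IsDecomposable L := by
  have key : ∀ I : LieIdeal ℝ L, I ≠ ⊥ → z ∈ I := by
    intro I hI
    have of_smul : ∀ c : ℝ, c • z ≠ 0 → c • z ∈ I → z ∈ I := fun c hne hc => by
      have hc0 : c ≠ 0 := by rintro rfl; simp at hne
      simpa [smul_smul, hc0] using I.smul_mem c⁻¹ hc
    rw [Ne, ← LieSubmodule.toSubmodule_eq_bot, ← Ne] at hI
    obtain ⟨x, hxI, hx⟩ := Submodule.exists_mem_ne_zero_of_ne_bot hI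
    by_cases hxc : ∀ y : L, ⁅x, y⁆ = 0
    · obtain ⟨c, rfl⟩ := hcenter x hxc
      exact of_smul c hx hxI
    · push Not at hxc
      obtain ⟨y, hy⟩ := hxc
      obtain ⟨c, hc⟩ := hlie x y
      have hmem : ⁅x, y⁆ ∈ I := lie_mem_left ℝ L I x y hxI
      rw [hc] at hy hmem
      exact of_smul c hy hmem
  rintro ⟨I, J, hI, hJ, hIJ⟩
  have : z ∈ I ⊓ J := ⟨key I hI, key J hJ⟩
  rw [hIJ.inf_eq_bot] at this
  exact hz (by simpa using this)

lemma finrank_derivedSeries_one_eq_one_of_lie_eq_smul {z : L}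
    (hlie : ∀ x y : L, ∃ c : ℝ, ⁅x, y⁆ = c • z) {a b : L} (hab : ⁅a, b⁆ = z) (hz : z ≠ 0) :
    Module.finrank ℝ (LieAlgebra.derivedSeries ℝ L 1) = 1 := by
  have hzD : z ∈ LieAlgebra.derivedSeries ℝ L 1 :=
    hab ▸ LieSubmodule.lie_mem_lie (LieSubmodule.mem_top a) (LieSubmodule.mem_top b)
  have hD : ∀ x ∈ LieAlgebra.derivedSeries ℝ L 1, x ∈ Submodule.span ℝ {z} := by
    intro x (hx : x ∈ (LieAlgebra.derivedSeries ℝ L 1).toLieSubalgebra.toSubmodule)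
    rw [LieAlgebra.coe_derivedSeries_one_eq] at hx
    refine Submodule.span_le.2 ?_ hx
    rintro _ ⟨u, v, rfl⟩
    obtain ⟨c, hc⟩ := hlie u v
    exact Submodule.mem_span_singleton.2 ⟨c, hc.symm⟩
  refine finrank_eq_one_iff'.2 ⟨⟨z, hzD⟩, fun h => hz (congrArg Subtype.val h), fun x => ?_⟩
  obtain ⟨c, hc⟩ := Submodule.mem_span_singleton.1 (hD x x.2)
  exact ⟨c, Subtype.ext hc⟩

lemma exists_lie_eq_smul_of_finrank_derivedSeries_one
    (h : Module.finrank ℝ (LieAlgebra.derivedSeries ℝ L 1) = 1) :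
    ∃ z : L, z ≠ 0 ∧ ∀ x y : L, ∃ c : ℝ, ⁅x, y⁆ = c • z := by
  obtain ⟨z, hz, hspan⟩ := finrank_eq_one_iff'.1 h
  refine ⟨z, fun h => hz (Subtype.ext h), fun x y => ?_⟩
  obtain ⟨c, hc⟩ := hspan
    ⟨⁅x, y⁆, LieSubmodule.lie_mem_lie (LieSubmodule.mem_top x) (LieSubmodule.mem_top y)⟩
  exact ⟨c, (congrArg Subtype.val hc).symm⟩

end LieAlgebra

namespace Heisenberg

variable {m : ℕ}

lemma finrank_eq (m : ℕ) : Module.finrank ℝ (Heisenberg m) = 2 * m + 1 := by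
  change Module.finrank ℝ ((Fin m → ℝ) × (Fin m → ℝ) × ℝ) = _
  simp
  ring

/-- The element of the Heisenberg Lie algebra with given components. -/
def mk (x y : Fin m → ℝ) (t : ℝ) : Heisenberg m := (x, y, t)

@[simp] lemma mk_fst (x y : Fin m → ℝ) (t : ℝ) : (mk x y t).1 = x := rfl

@[simp] lemma mk_snd_fst (x y : Fin m → ℝ) (t : ℝ) : (mk x y t).2.1 = y := rfl

@[simp] lemma mk_snd_snd (x y : Fin m → ℝ) (t : ℝ) : (mk x y t).2.2 = t := rfl

lemma lie_eq_mk (x y : Heisenberg m) :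
    ⁅x, y⁆ = mk 0 0 (∑ i, (x.1 i * y.2.1 i - y.1 i * x.2.1 i)) := rfl

/-- The standard generator of the centre of the Heisenberg Lie algebra. -/
def centralVector (m : ℕ) : Heisenberg m := mk 0 0 1

lemma mk_zero_zero (c : ℝ) : mk 0 0 c = c • centralVector m := by
  change _ = c • ((0, 0, 1) : (Fin m → ℝ) × (Fin m → ℝ) × ℝ)
  simp [mk]

lemma centralVector_ne_zero : centralVector m ≠ 0 := fun h =>
  one_ne_zero (congrArg (fun v : Heisenberg m => v.2.2) h : (1 : ℝ) = 0)

lemma lie_eq_smul_centralVector (x y : Heisenberg m) : ∃ c : ℝ, ⁅x, y⁆ = c • centralVector m :=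
  ⟨_, (lie_eq_mk x y).trans (mk_zero_zero _)⟩

lemma eq_smul_centralVector_of_central (x : Heisenberg m) (hx : ∀ y : Heisenberg m, ⁅x, y⁆ = 0) :
    ∃ c : ℝ, x = c • centralVector m := by
  have h : ∀ y : Heisenberg m, ∑ i, (x.1 i * y.2.1 i - y.1 i * x.2.1 i) = 0 := fun y =>
    congrArg (fun v : Heisenberg m => v.2.2) (hx y)
  have h1 : x.1 = 0 := funext fun j => by
    simpa [Pi.single_apply] using h (mk 0 (Pi.single j 1) 0)
  have h2 : x.2.1 = 0 := funext fun j => by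
    simpa [Pi.single_apply] using h (mk (Pi.single j 1) 0 0)
  exact ⟨x.2.2, (Prod.ext h1 (Prod.ext h2 rfl) : x = mk 0 0 x.2.2).trans (mk_zero_zero _)⟩

lemma exists_lie_eq_centralVector (hm : 0 < m) :
    ∃ a b : Heisenberg m, ⁅a, b⁆ = centralVector m := by
  refine ⟨mk (Pi.single ⟨0, hm⟩ 1) 0 0, mk 0 (Pi.single ⟨0, hm⟩ 1) 0, ?_⟩
  rw [lie_eq_mk, centralVector]
  simp [Pi.single_apply]

variable {L : Type*} [LieRing L] [LieAlgebra ℝ L]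

/-- The homomorphism from the Heisenberg Lie algebra determined by vectors satisfying the
canonical commutation relations. -/
noncomputable def lift (p q : Fin m → L) (z : L) (hz : ∀ x : L, ⁅x, z⁆ = 0)
    (hpp : ∀ i j, ⁅p i, p j⁆ = 0) (hqq : ∀ i j, ⁅q i, q j⁆ = 0)
    (hpq : ∀ i j, ⁅p i, q j⁆ = if i = j then z else 0) : Heisenberg m →ₗ⁅ℝ⁆ L where
  toFun v := ∑ i, v.1 i • p i + ∑ i, v.2.1 i • q i + v.2.2 • z
  map_add' v w := by
    change ∑ i, (v.1 i + w.1 i) • p i + ∑ i, (v.2.1 i + w.2.1 i) • q i + (v.2.2 + w.2.2) • z = _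
    simp only [add_smul, Finset.sum_add_distrib]
    abel
  map_smul' c v := by
    change ∑ i, (c * v.1 i) • p i + ∑ i, (c * v.2.1 i) • q i + (c * v.2.2) • z = _
    simp only [mul_smul, ← Finset.smul_sum, ← smul_add, RingHom.id_apply]
  map_lie' {v w} := by
    have hqp : ∀ i j, ⁅q i, p j⁆ = if i = j then -z else 0 := fun i j => by
      rw [← lie_skew, hpq]
      simp only [eq_comm (a := j)]
      split_ifs <;> simp
    have hz' : ∀ x : L, ⁅z, x⁆ = 0 := fun x => by rw [← lie_skew, hz, neg_zero]
    change ∑ i, (0 : ℝ) • p i + ∑ i, (0 : ℝ) • q i +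
      (∑ i, (v.1 i * w.2.1 i - w.1 i * v.2.1 i)) • z = _
    simp only [add_lie, lie_add, smul_lie, lie_smul, lie_sum, sum_lie, hpp, hqq, hpq, hqp, hz, hz',
      smul_zero, smul_ite, Finset.sum_const_zero, Finset.sum_ite_eq',
      Finset.mem_univ, if_true, add_zero, zero_add, zero_smul]
    simp only [Finset.sum_smul, smul_smul, smul_neg, Finset.sum_neg_distrib, sub_smul,
      Finset.sum_sub_distrib, mul_comm]
    abel

end Heisenberg

/-- A finite-dimensional Lie algebra whose brackets lie on a line equal to the centre is a
Heisenberg Lie algebra. -/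
lemma exists_lieEquiv_heisenberg {L : Type*} [LieRing L] [LieAlgebra ℝ L] [Module.Finite ℝ L]
    {z : L} (hz : z ≠ 0) (hlie : ∀ x y : L, ∃ c : ℝ, ⁅x, y⁆ = c • z) (hzc : ∀ x : L, ⁅x, z⁆ = 0)
    (hcenter : ∀ w : L, (∀ x : L, ⁅x, w⁆ = 0) → w ∈ Submodule.span ℝ {z}) :
    ∃ m : ℕ, Nonempty (L ≃ₗ⁅ℝ⁆ Heisenberg m) := by
  obtain ⟨F, hF⟩ := Module.Projective.exists_dual_eq_one ℝ hz
  have hB : ∀ x y : L, ⁅x, y⁆ = kirillovForm F x y • z := fun x y => by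
    obtain ⟨c, hc⟩ := hlie x y
    rw [kirillovForm_apply, hc, map_smul, hF, smul_eq_mul, mul_one]
  have hAlt := kirillovForm_isAlt F
  obtain ⟨m, p, q, h, hspan⟩ := exists_isHyperbolicFamily (kirillovForm F) hAlt
  let φ : Heisenberg m →ₗ⁅ℝ⁆ L := Heisenberg.lift p q z hzc
    (fun i j => by simp [hB, h.left_left]) (fun i j => by simp [hB, h.right_right])
    (fun i j => by simp [hB, h.left_right])
  have hφ : ∀ v, φ v = ∑ i, v.1 i • p i + ∑ i, v.2.1 i • q i + v.2.2 • z := fun v => rfl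
  have hBz : ∀ x, kirillovForm F x z = 0 := fun x => by simp [kirillovForm_apply, hzc]
  refine ⟨m, ⟨(LieEquiv.ofBijective φ ⟨?_, fun v => ?_⟩).symm⟩⟩
  · rw [injective_iff_map_eq_zero]
    intro v hv
    rw [hφ] at hv
    have h1 : v.1 = 0 := funext fun j => by
      have := congrArg (kirillovForm F (q j)) hv
      rw [map_add, h.apply_right hAlt, map_smul, hBz] at this
      simpa using this
    have h2 : v.2.1 = 0 := funext fun j => by
      have := congrArg (kirillovForm F (p j)) hv
      rw [map_add, h.apply_left, map_smul, hBz] at this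
      simpa using this
    have h3 : v.2.2 = 0 := by simpa [h1, h2, hz] using hv
    exact Prod.ext h1 (Prod.ext h2 h3)
  · obtain ⟨x, y, hxy⟩ := hspan v
    obtain ⟨c, hc⟩ := Submodule.mem_span_singleton.1
      (hcenter (v - (∑ i, x i • p i + ∑ i, y i • q i)) fun u => by
        rw [← lie_skew, hB, hxy]; simp)
    refine ⟨Heisenberg.mk x y c, ?_⟩
    simp only [hφ, Heisenberg.mk_fst, Heisenberg.mk_snd_fst, Heisenberg.mk_snd_snd, hc]
    abel

/-- A real Lie algebra of finite dimension `n ≥ 3` is indecomposable with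
1-dimensional derived ideal if and only if `n = 2m+1` for some positive integer `m` and `𝔤` is
isomorphic to the Heisenberg Lie algebra `𝔥_{2m+1}`. -/
theorem indecomposable_derived_one_dimensional_iff_heisenberg
    {L : Type*} [LieRing L] [LieAlgebra ℝ L] [Module.Finite ℝ L]
    (n : ℕ) (hn : 3 ≤ n) (hdim : Module.finrank ℝ L = n) :
    (¬ IsDecomposable L ∧ Module.finrank ℝ (LieAlgebra.derivedSeries ℝ L 1) = 1) ↔
      (∃ m : ℕ, 0 < m ∧ n = 2 * m + 1 ∧ Nonempty (L ≃ₗ⁅ℝ⁆ Heisenberg m)) := by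
  constructor
  · rintro ⟨hind, hder⟩
    obtain ⟨z, hz, hlie⟩ := exists_lie_eq_smul_of_finrank_derivedSeries_one hder
    have hzc : ∀ x : L, ⁅x, z⁆ = 0 := fun x => by
      by_contra hx
      exact hind (isDecomposable_of_lie_eq_smul_of_not_central (hdim ▸ hn) hlie hx)
    obtain ⟨m, ⟨e⟩⟩ := exists_lieEquiv_heisenberg hz hlie hzc fun w hw => by
      by_contra hwz
      exact hind (isDecomposable_of_lie_eq_smul_of_central hz hlie hw hwz)
    have hm : n = 2 * m + 1 := by
      rw [← hdim, e.toLinearEquiv.finrank_eq, Heisenberg.finrank_eq]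
    exact ⟨m, by omega, hm, ⟨e⟩⟩
  · rintro ⟨m, hm, -, ⟨e⟩⟩
    have hz : e.symm (Heisenberg.centralVector m) ≠ 0 := fun h =>
      Heisenberg.centralVector_ne_zero (by simpa using congrArg e h)
    have hlie : ∀ x y : L, ∃ c : ℝ, ⁅x, y⁆ = c • e.symm (Heisenberg.centralVector m) :=
      fun x y => by
        obtain ⟨c, hc⟩ := Heisenberg.lie_eq_smul_centralVector (e x) (e y)
        exact ⟨c, e.injective (by simp [hc])⟩
    obtain ⟨a, b, hab⟩ := Heisenberg.exists_lie_eq_centralVector hm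
    refine ⟨not_isDecomposable_of_lie_eq_smul hz hlie fun x hx => ?_,
      finrank_derivedSeries_one_eq_one_of_lie_eq_smul hlie (a := e.symm a) (b := e.symm b)
        (by rw [← LieEquiv.map_lie, hab]) hz⟩
    obtain ⟨c, hc⟩ := Heisenberg.eq_smul_centralVector_of_central (e x) fun y => by
      rw [← e.apply_symm_apply y, ← LieEquiv.map_lie, hx, map_zero]
    exact ⟨c, e.injective (by simp [hc])⟩
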